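/- Fix an integer N ≥ 2 and let μ be a non-atomic Borel probability measure on [0,1] such that F_{N,0}(x) := μ([0,x]) is twice continuously differentiable on [0,1]. Set q_N := Σ_{i≥N} (1/i³ + N/(i²(i+1))). Then 0 < q_N < 1 and there exists a constant C > 0 such that for all n ∈ ℕ and all x ∈ [0,1], |F_{N,n}(x) − log((x+N−1)/(N−1)) / log(N/(N−1))| ≤ C·q_N^n, where F_{N,n}(x) := μ({y ∈ [0,1] : R_N^n(y) ≤ x}). -/

import Mathlib

open MeasureTheory Set Filter

/-- The Rényi-type continued fraction transformation
`R_N(x) = N/(1-x) - ⌊N/(1-x)⌋` for `x ≠ 1`, and `R_N(1) = 0`. -/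
noncomputable def renyiMap (N : ℕ) (x : ℝ) : ℝ :=
  if x = 1 then 0 else Int.fract ((N : ℝ) / (1 - x))

/-- `F_{N,n}(x) = μ {y ∈ [0,1] : R_N^n(y) ≤ x}`. -/
noncomputable def Fdist (N : ℕ) (μ : Measure ℝ) (n : ℕ) (x : ℝ) : ℝ :=
  (μ {y ∈ Icc (0 : ℝ) 1 | (renyiMap N)^[n] y ≤ x}).toReal

/-- `q_N = ∑_{i ≥ N} (1/i³ + N/(i²(i+1)))`, written as a sum over `i = j + N`, `j : ℕ`. -/
noncomputable def qConst (N : ℕ) : ℝ :=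
  ∑' j : ℕ, (1 / (((j + N : ℕ) : ℝ)) ^ 3 +
    (N : ℝ) / ((((j + N : ℕ) : ℝ)) ^ 2 * (((j + N : ℕ) : ℝ) + 1)))

/-- The inverse branch of `R_N` with digit `N + k`. -/
noncomputable def renyiBranch (N k : ℕ) (x : ℝ) : ℝ := 1 - N / (x + N + k)

/-- The transition weight of the inverse branch with digit `N + k`, relative to the invariant
density `1 / (x + N - 1)`. -/
noncomputable def branchWeight (N k : ℕ) (x : ℝ) : ℝ :=
  (x + N - 1) / ((x + N + k) * (x + N + k - 1))

/-- The transfer operator of `R_N` with respect to its invariant density. -/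
noncomputable def transferOp (N : ℕ) (f : ℝ → ℝ) (x : ℝ) : ℝ :=
  ∑' k, branchWeight N k x * f (renyiBranch N k x)

lemma hasSum_sub_succ {g : ℕ → ℝ} (hanti : ∀ k, g (k + 1) ≤ g k) (hnonneg : ∀ k, 0 ≤ g k)
    (hle : ∀ k : ℕ, g k ≤ 1 / ((k : ℝ) + 1)) : HasSum (fun k => g k - g (k + 1)) (g 0) := by
  rw [hasSum_iff_tendsto_nat_of_nonneg fun k => sub_nonneg.2 (hanti k)]
  have hlim : Tendsto g atTop (nhds 0) :=
    squeeze_zero hnonneg hle tendsto_one_div_add_atTop_nhds_zero_nat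
  simp only [Finset.sum_range_sub']
  simpa using hlim.const_sub (g 0)

lemma summable_one_div_add_pow {s : ℝ} (hs : 1 ≤ s) {p : ℕ} (hp : 2 ≤ p) :
    Summable fun k : ℕ => 1 / (s + k) ^ p := by
  have h : Summable fun k : ℕ => 1 / ((k : ℝ) + 1) ^ p := by
    have := (summable_nat_add_iff 1).2 (Real.summable_one_div_nat_pow.2 (show 1 < p by omega))
    simpa using this
  refine h.of_nonneg_of_le (fun k => by positivity) fun k => ?_
  gcongr 1 / ?_ ^ p
  linarith

lemma hasSum_one_div_mul_add_one {a : ℝ} (ha : 1 ≤ a) :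
    HasSum (fun k : ℕ => 1 / ((a + k) * (a + k + 1))) (1 / a) := by
  have h := hasSum_sub_succ (g := fun k : ℕ => 1 / (a + k))
    (fun k => by push_cast; gcongr; linarith) (fun k => by positivity)
    (fun k => by gcongr 1 / ?_; linarith)
  convert h using 1
  · ext k
    have : 0 < a + k := by positivity
    push_cast
    field_simp
    ring
  · simp

lemma hasSum_one_div_mul_sq_sub_one {s : ℝ} (hs : 2 ≤ s) :
    HasSum (fun k : ℕ => 1 / ((s + k) * ((s + k) ^ 2 - 1))) (1 / (2 * s * (s - 1))) := by
  have hk : ∀ k : ℕ, (0 : ℝ) ≤ k := fun k => k.cast_nonneg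
  have h := hasSum_sub_succ (g := fun k : ℕ => 1 / (2 * (s + k) * (s + k - 1)))
    (fun k => by
      have := hk k
      push_cast
      apply one_div_le_one_div_of_le
      · exact mul_pos (by linarith) (by linarith)
      · nlinarith)
    (fun k => by
      have := hk k
      exact one_div_nonneg.2 (mul_nonneg (by linarith) (by linarith)))
    (fun k => by
      have := hk k
      apply one_div_le_one_div_of_le
      · linarith
      · nlinarith)
  convert h using 1
  · ext k
    have := hk k
    have h1 : s + k ≠ 0 := by positivity
    have h2 : s + k - 1 ≠ 0 := by linarith
    have h3 : s + k + 1 ≠ 0 := by positivity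
    have h4 : (s + k) ^ 2 - 1 ≠ 0 := by nlinarith
    push_cast
    rw [show s + ((k : ℝ) + 1) - 1 = s + k by ring, ← add_assoc]
    field_simp
    ring
  · simp

lemma one_div_le_tsum_one_div_cube {s : ℝ} (hs : 2 ≤ s) :
    1 / (2 * s ^ 2 - 2 * s + 1) ≤ ∑' k : ℕ, 1 / (s + k) ^ 3 := by
  have hk : ∀ k : ℕ, (0 : ℝ) ≤ k := fun k => k.cast_nonneg
  have h := hasSum_sub_succ (g := fun k : ℕ => 1 / (2 * (s + k) ^ 2 - 2 * (s + k) + 1))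
    (fun k => by
      have := hk k
      push_cast
      apply one_div_le_one_div_of_le <;> nlinarith)
    (fun k => by
      have := hk k
      exact one_div_nonneg.2 (by nlinarith))
    (fun k => by
      have := hk k
      apply one_div_le_one_div_of_le <;> nlinarith)
  simp only [Nat.cast_zero, add_zero] at h
  refine hasSum_le (fun k => ?_) h (summable_one_div_add_pow (by linarith) (by norm_num)).hasSum
  have := hk k
  push_cast
  rw [← add_assoc]
  obtain ⟨t, ht⟩ : ∃ t, t = s + k := ⟨_, rfl⟩
  rw [← ht]
  have ht2 : 2 ≤ t := by linarith
  have h1 : 0 < 2 * t ^ 2 - 2 * t + 1 := by nlinarith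
  have h2 : 0 < 2 * (t + 1) ^ 2 - 2 * (t + 1) + 1 := by nlinarith
  rw [div_sub_div _ _ h1.ne' h2.ne', div_le_div_iff₀ (by positivity) (by positivity)]
  nlinarith

lemma hasSum_one_div_sub_half_pow {s : ℝ} (hs : 2 ≤ s) :
    HasSum (fun k : ℕ => 1 / (4 * (s + k - 1 / 2) ^ 4) - 1 / (4 * (s + k + 1 / 2) ^ 4))
      (1 / (4 * (s - 1 / 2) ^ 4)) := by
  have hk : ∀ k : ℕ, (0 : ℝ) ≤ k := fun k => k.cast_nonneg
  have h := hasSum_sub_succ (g := fun k : ℕ => 1 / (4 * (s + k - 1 / 2) ^ 4))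
    (fun k => by
      have := hk k
      have : 0 < s + k - 1 / 2 := by linarith
      push_cast
      gcongr
      linarith)
    (fun k => by
      have := hk k
      have : 0 < s + k - 1 / 2 := by linarith
      positivity)
    (fun k => by
      have := hk k
      have h1 : (k : ℝ) + 1 ≤ s + k - 1 / 2 := by linarith
      have h2 : s + k - 1 / 2 ≤ (s + k - 1 / 2) ^ 4 := le_self_pow₀ (by linarith) (by norm_num)
      apply one_div_le_one_div_of_le <;> linarith)
  convert h using 1
  · ext k
    push_cast
    ring_nf
  · simp

lemma one_div_sq_sub_le {a t : ℝ} (ha : 0 ≤ a) (ht : 2 ≤ t) :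
    1 / t ^ 2 - 2 * a * (1 / t ^ 3) ≤ 1 / (t ^ 2 * (t + 1)) +
      2 * a * (1 / (4 * (t - 1 / 2) ^ 4) - 1 / (4 * (t + 1 / 2) ^ 4)) +
      1 / (t * (t + 1)) - 2 * a * (1 / (t * (t ^ 2 - 1))) := by
  have hsq : 0 < t ^ 2 - 1 := by nlinarith
  have hm : 0 < t - 1 / 2 := by linarith
  have hmain : 1 / (t ^ 3 * (t ^ 2 - 1)) ≤
      1 / (4 * (t - 1 / 2) ^ 4) - 1 / (4 * (t + 1 / 2) ^ 4) := by
    rw [div_sub_div _ _ (by positivity) (by positivity),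
      div_le_div_iff₀ (by positivity) (by positivity)]
    have hz : 0 ≤ (t ^ 2) ^ 3 - 5 / 2 * (t ^ 2) ^ 2 + t ^ 2 / 4 - 1 / 64 := by
      nlinarith [mul_nonneg (sq_nonneg (t ^ 2)) (show 0 ≤ t ^ 2 - 4 by nlinarith)]
    nlinarith
  have h1 : 1 / t ^ 2 = 1 / (t ^ 2 * (t + 1)) + 1 / (t * (t + 1)) := by field_simp; ring
  have h2 : 1 / (t * (t ^ 2 - 1)) - 1 / t ^ 3 = 1 / (t ^ 3 * (t ^ 2 - 1)) := by
    field_simp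
    ring
  nlinarith [mul_le_mul_of_nonneg_left hmain ha]

lemma summable_one_div_sq_mul {s : ℝ} (hs : 1 ≤ s) :
    Summable fun k : ℕ => 1 / ((s + k) ^ 2 * (s + k + 1)) := by
  refine (summable_one_div_add_pow hs le_rfl).of_nonneg_of_le (fun k => by positivity) fun k => ?_
  have : (0 : ℝ) ≤ k := k.cast_nonneg
  gcongr 1 / ?_
  exact le_mul_of_one_le_right (by positivity) (by linarith)

lemma tsum_one_div_sq_sub_le {s : ℝ} (hs : 2 ≤ s) :
    ∑' k : ℕ, 1 / (s + k) ^ 2 - 2 * (s - 1) * ∑' k : ℕ, 1 / (s + k) ^ 3 ≤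
      ∑' k : ℕ, 1 / ((s + k) ^ 2 * (s + k + 1)) + 2 * (s - 1) * (1 / (4 * (s - 1 / 2) ^ 4)) := by
  have h1 : 1 ≤ s := by linarith
  have hl := (summable_one_div_add_pow h1 le_rfl).hasSum.sub
    ((summable_one_div_add_pow h1 (p := 3) (by norm_num)).hasSum.mul_left (2 * (s - 1)))
  have hr := (((summable_one_div_sq_mul h1).hasSum.add
    ((hasSum_one_div_sub_half_pow hs).mul_left (2 * (s - 1)))).add
    (hasSum_one_div_mul_add_one h1)).sub
    ((hasSum_one_div_mul_sq_sub_one hs).mul_left (2 * (s - 1)))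
  have hle := hasSum_le (fun k : ℕ => one_div_sq_sub_le (a := s - 1) (by linarith)
    (show 2 ≤ s + k by linarith [k.cast_nonneg (α := ℝ)])) hl hr
  have hz : 1 / s - 2 * (s - 1) * (1 / (2 * s * (s - 1))) = 0 := by
    have : s - 1 ≠ 0 := by linarith
    field_simp
    ring
  linarith

lemma qConst_eq {N : ℕ} (hN : 2 ≤ N) :
    qConst N = ∑' k : ℕ, 1 / ((N : ℝ) + k) ^ 3 +
      N * ∑' k : ℕ, 1 / (((N : ℝ) + k) ^ 2 * (N + k + 1)) := by
  have h1 : (1 : ℝ) ≤ N := by exact_mod_cast (by omega : 1 ≤ N)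
  rw [← tsum_mul_left, ← Summable.tsum_add (summable_one_div_add_pow h1 (by norm_num))
    ((summable_one_div_sq_mul h1).mul_left _), qConst]
  congr 1
  ext k
  push_cast
  rw [add_comm (k : ℝ)]
  ring

lemma qConst_pos {N : ℕ} (hN : 2 ≤ N) : 0 < qConst N := by
  have h2 : (2 : ℝ) ≤ N := by exact_mod_cast hN
  rw [qConst_eq hN]
  refine add_pos_of_pos_of_nonneg (lt_of_lt_of_le ?_ (one_div_le_tsum_one_div_cube h2))
    (mul_nonneg (by positivity) (tsum_nonneg fun k => by positivity))
  exact one_div_pos.2 (by nlinarith)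

lemma qConst_lt_one {N : ℕ} (hN : 2 ≤ N) : qConst N < 1 := by
  have h2 : (2 : ℝ) ≤ N := by exact_mod_cast hN
  have h1 : (1 : ℝ) ≤ N := by linarith
  have hM := hasSum_one_div_mul_sq_sub_one h2
  have hcube := hasSum_le (fun k : ℕ => show 1 / ((N : ℝ) + k) ^ 3 ≤
      1 / ((N + k) * ((N + k) ^ 2 - 1)) by
    have : (0 : ℝ) ≤ k := k.cast_nonneg
    have ht : (2 : ℝ) ≤ N + k := by linarith
    apply one_div_le_one_div_of_le
    · exact mul_pos (by linarith) (by nlinarith)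
    · nlinarith) (summable_one_div_add_pow h1 (by norm_num)).hasSum hM
  have hsq := hasSum_le (fun k : ℕ => show 1 / (((N : ℝ) + k) ^ 2 * (N + k + 1)) ≤
      1 / ((N + k) * ((N + k) ^ 2 - 1)) by
    have : (0 : ℝ) ≤ k := k.cast_nonneg
    have ht : (2 : ℝ) ≤ N + k := by linarith
    apply one_div_le_one_div_of_le
    · exact mul_pos (by linarith) (by nlinarith)
    · nlinarith) (summable_one_div_sq_mul h1).hasSum hM
  rw [qConst_eq hN]
  have hle := mul_le_mul_of_nonneg_left hsq (by linarith : (0 : ℝ) ≤ N)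
  have hlt : 1 / (2 * (N : ℝ) * (N - 1)) + N * (1 / (2 * (N : ℝ) * (N - 1))) < 1 := by
    have : (0 : ℝ) < N - 1 := by linarith
    rw [← one_add_mul, mul_one_div, div_lt_one (by positivity)]
    nlinarith
  linarith

/-- The derivative of the transfer operator applied to the identity is at most `q_N`. -/
lemma tsum_sub_le_qConst {N : ℕ} (hN : 2 ≤ N) {x : ℝ} (hx : 0 ≤ x) :
    N * (∑' k : ℕ, 1 / (x + N + k) ^ 2 -
      2 * (x + N - 1) * ∑' k : ℕ, 1 / (x + N + k) ^ 3) ≤ qConst N := by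
  have h2 : (2 : ℝ) ≤ N := by exact_mod_cast hN
  have hmain := tsum_one_div_sq_sub_le (s := x + N) (by linarith)
  have hcube := one_div_le_tsum_one_div_cube h2
  have hfirst : ∑' k : ℕ, 1 / ((x + N + k) ^ 2 * (x + N + k + 1)) ≤
      ∑' k : ℕ, 1 / (((N : ℝ) + k) ^ 2 * (N + k + 1)) := by
    refine Summable.tsum_le_tsum (fun k => ?_) (summable_one_div_sq_mul (by linarith))
      (summable_one_div_sq_mul (by linarith))
    gcongr <;> linarith
  have hsecond : N * (2 * (x + N - 1) * (1 / (4 * (x + N - 1 / 2) ^ 4))) ≤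
      1 / (2 * (N : ℝ) ^ 2 - 2 * N + 1) := by
    have hpos : 0 < 2 * (N : ℝ) ^ 2 - 2 * N + 1 := by nlinarith
    have hpos' : 0 < x + N - 1 / 2 := by linarith
    rw [← mul_assoc, mul_one_div, div_le_div_iff₀ (by positivity) hpos]
    obtain ⟨v, hv⟩ : ∃ v, v = (N : ℝ) - 1 / 2 := ⟨_, rfl⟩
    have hN' : (N : ℝ) = v + 1 / 2 := by linarith
    rw [show x + N - 1 / 2 = x + v by linarith, hN']
    have hv0 : 3 / 2 ≤ v := by linarith
    have : 2 * v ^ 4 + 8 * x * v ^ 3 ≤ 2 * (x + v) ^ 4 := by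
      have : 0 ≤ x ^ 2 * (2 * x ^ 2 + 8 * x * v + 12 * v ^ 2) := by positivity
      nlinarith
    have : 0 ≤ x * (6 * v ^ 3 - v ^ 2 - v - 1 / 4) :=
      mul_nonneg hx (by nlinarith [mul_nonneg (sq_nonneg v) (sub_nonneg.2 hv0)])
    nlinarith
  rw [qConst_eq hN]
  have := mul_le_mul_of_nonneg_left (hmain.trans (add_le_add_left hfirst _))
    (by linarith : (0 : ℝ) ≤ N)
  linarith

lemma renyiBranch_mem_Ico {N : ℕ} (hN : 2 ≤ N) (k : ℕ) {x : ℝ} (hx : 0 ≤ x) :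
    renyiBranch N k x ∈ Ico (0 : ℝ) 1 := by
  have h2 : (2 : ℝ) ≤ N := by exact_mod_cast hN
  have hk : (0 : ℝ) ≤ k := k.cast_nonneg
  have hle : (N : ℝ) / (x + N + k) ≤ 1 := div_le_one_of_le₀ (by linarith) (by positivity)
  have hpos : 0 < (N : ℝ) / (x + N + k) := by positivity
  rw [renyiBranch]
  exact ⟨by linarith, by linarith⟩

lemma renyiBranch_mem_Icc {N : ℕ} (hN : 2 ≤ N) (k : ℕ) {x : ℝ} (hx : 0 ≤ x) :
    renyiBranch N k x ∈ Icc (0 : ℝ) 1 :=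
  Ico_subset_Icc_self (renyiBranch_mem_Ico hN k hx)

lemma renyiBranch_le_renyiBranch {N : ℕ} (hN : 2 ≤ N) {k l : ℕ} {x y : ℝ} (hx : 0 ≤ x)
    (hxy : x + k ≤ y + l) : renyiBranch N k x ≤ renyiBranch N l y := by
  have h2 : (2 : ℝ) ≤ N := by exact_mod_cast hN
  have hk : (0 : ℝ) ≤ k := k.cast_nonneg
  have : (N : ℝ) / (y + N + l) ≤ N / (x + N + k) :=
    div_le_div_of_nonneg_left (by linarith) (by positivity) (by linarith)
  rw [renyiBranch, renyiBranch]
  linarith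

lemma branchWeight_nonneg {N : ℕ} (hN : 2 ≤ N) (k : ℕ) {x : ℝ} (hx : 0 ≤ x) :
    0 ≤ branchWeight N k x := by
  have h2 : (2 : ℝ) ≤ N := by exact_mod_cast hN
  have hk : (0 : ℝ) ≤ k := k.cast_nonneg
  exact div_nonneg (by linarith) (mul_nonneg (by linarith) (by linarith))

lemma hasSum_branchWeight {N : ℕ} (hN : 2 ≤ N) {x : ℝ} (hx : 0 ≤ x) :
    HasSum (fun k => branchWeight N k x) 1 := by
  have h2 : (2 : ℝ) ≤ N := by exact_mod_cast hN
  have h := (hasSum_one_div_mul_add_one (a := x + N - 1) (by linarith)).mul_left (x + N - 1)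
  rw [mul_one_div_cancel (by linarith)] at h
  have heq : ∀ k : ℕ, branchWeight N k x =
      (x + N - 1) * (1 / ((x + N - 1 + k) * (x + N - 1 + k + 1))) := fun k => by
    rw [branchWeight, mul_one_div]
    ring_nf
  simpa only [heq] using h

lemma branchWeight_eq_sub {N : ℕ} (hN : 2 ≤ N) (k : ℕ) {x : ℝ} (hx : 0 ≤ x) :
    branchWeight N k x =
      (x + N - 1) / (x + N - 1 + k) - (x + N - 1) / (x + N - 1 + (k + 1 : ℕ)) := by
  have h2 : (2 : ℝ) ≤ N := by exact_mod_cast hN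
  have hk : (0 : ℝ) ≤ k := k.cast_nonneg
  have h1 : x + N + k - 1 ≠ 0 := by linarith
  have h3 : x + N + k ≠ 0 := by linarith
  rw [branchWeight, show x + N - 1 + k = x + N + k - 1 by ring,
    show x + N - 1 + (k + 1 : ℕ) = x + N + k by push_cast; ring]
  field_simp
  ring

lemma summable_branchWeight_mul {N : ℕ} (hN : 2 ≤ N) {x M : ℝ} (hx : 0 ≤ x) {b : ℕ → ℝ}
    (hb : ∀ k, |b k| ≤ M) : Summable fun k => branchWeight N k x * b k := by
  refine Summable.of_norm_bounded ((hasSum_branchWeight hN hx).summable.mul_right M) fun k => ?_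
  rw [Real.norm_eq_abs, abs_mul, abs_of_nonneg (branchWeight_nonneg hN k hx)]
  exact mul_le_mul_of_nonneg_left (hb k) (branchWeight_nonneg hN k hx)

/-- The weights are stochastically increasing in `x`. -/
lemma tsum_branchWeight_mul_le {N : ℕ} (hN : 2 ≤ N) {x y M : ℝ} (hx : 0 ≤ x) (hxy : x ≤ y)
    {b : ℕ → ℝ} (hb : ∀ k, |b k| ≤ M) (hmono : Monotone b) :
    ∑' k, branchWeight N k x * b k ≤ ∑' k, branchWeight N k y * b k := by
  have h2 : (2 : ℝ) ≤ N := by exact_mod_cast hN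
  have hy : 0 ≤ y := hx.trans hxy
  set D : ℕ → ℝ := fun k => (y + N - 1) / (y + N - 1 + k) - (x + N - 1) / (x + N - 1 + k) with hD
  have hDnonneg : ∀ k, 0 ≤ D k := fun k => by
    have hk : (0 : ℝ) ≤ k := k.cast_nonneg
    rw [hD, sub_nonneg, div_le_div_iff₀ (by linarith) (by linarith)]
    nlinarith
  have hDzero : D 0 = 0 := by
    simp only [hD, Nat.cast_zero, add_zero]
    rw [div_self (by linarith), div_self (by linarith), sub_self]
  have hDlim : Tendsto (fun n => -(D n * M)) atTop (nhds 0) := by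
    have hlim : ∀ a : ℝ, Tendsto (fun k : ℕ => a / (a + k)) atTop (nhds 0) := fun a =>
      tendsto_const_nhds.div_atTop (tendsto_atTop_add_const_left _ _ tendsto_natCast_atTop_atTop)
    simpa using (((hlim (y + N - 1)).sub (hlim (x + N - 1))).mul_const M).neg
  have hpartial : ∀ n, -(D n * b n) ≤
      ∑ k ∈ Finset.range n, (branchWeight N k y * b k - branchWeight N k x * b k) := fun n => by
    induction n with
    | zero => simp [hDzero]
    | succ n ih =>
      have hstep : branchWeight N n y * b n - branchWeight N n x * b n =
          (D n - D (n + 1)) * b n := by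
        rw [branchWeight_eq_sub hN n hx, branchWeight_eq_sub hN n hy, hD]
        ring
      rw [Finset.sum_range_succ, hstep]
      nlinarith [mul_le_mul_of_nonneg_left (hmono n.le_succ) (hDnonneg (n + 1))]
  have hsx := summable_branchWeight_mul hN hx hb
  have hsy := summable_branchWeight_mul hN hy hb
  rw [← sub_nonneg, ← hsy.tsum_sub hsx]
  refine le_of_tendsto_of_tendsto' hDlim (hsy.sub hsx).hasSum.tendsto_sum_nat fun n => ?_
  exact (neg_le_neg (mul_le_mul_of_nonneg_left ((le_abs_self _).trans (hb n)) (hDnonneg n))).trans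
    (hpartial n)

lemma transferOp_le_transferOp {N : ℕ} (hN : 2 ≤ N) {f : ℝ → ℝ} {x y M : ℝ} (hx : 0 ≤ x)
    (hxy : x ≤ y) (hf : MonotoneOn f (Icc 0 1)) (hM : ∀ z ∈ Icc (0 : ℝ) 1, |f z| ≤ M) :
    transferOp N f x ≤ transferOp N f y := by
  have hy : 0 ≤ y := hx.trans hxy
  have hbx : ∀ k, |f (renyiBranch N k x)| ≤ M := fun k => hM _ (renyiBranch_mem_Icc hN k hx)
  have hby : ∀ k, |f (renyiBranch N k y)| ≤ M := fun k => hM _ (renyiBranch_mem_Icc hN k hy)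
  refine le_trans (Summable.tsum_le_tsum (fun k => ?_) (summable_branchWeight_mul hN hx hbx)
    (summable_branchWeight_mul hN hx hby)) (tsum_branchWeight_mul_le hN hx hxy hby ?_)
  · exact mul_le_mul_of_nonneg_left (hf (renyiBranch_mem_Icc hN k hx)
      (renyiBranch_mem_Icc hN k hy) (renyiBranch_le_renyiBranch hN hx (by linarith)))
      (branchWeight_nonneg hN k hx)
  · intro k l hkl
    have : (k : ℝ) ≤ l := by exact_mod_cast hkl
    exact hf (renyiBranch_mem_Icc hN k hy) (renyiBranch_mem_Icc hN l hy)
      (renyiBranch_le_renyiBranch hN hy (by linarith))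

lemma transferOp_id {N : ℕ} (hN : 2 ≤ N) {x : ℝ} (hx : 0 ≤ x) :
    transferOp N id x = (1 - N) + N * ((x + N - 1) * ∑' k : ℕ, 1 / (x + N + k) ^ 2) := by
  have h2 : (2 : ℝ) ≤ N := by exact_mod_cast hN
  have h := ((hasSum_branchWeight hN hx).mul_left (1 - (N : ℝ))).add
    (((summable_one_div_add_pow (s := x + N) (by linarith) le_rfl).hasSum.mul_left
      (x + N - 1)).mul_left (N : ℝ))
  rw [mul_one] at h
  rw [← h.tsum_eq, transferOp]
  congr 1
  ext k
  have hk : (0 : ℝ) ≤ k := k.cast_nonneg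
  have h1 : x + N + k - 1 ≠ 0 := by linarith
  have h3 : x + N + k ≠ 0 := by linarith
  rw [branchWeight, renyiBranch, id]
  field_simp
  ring

lemma hasDerivAt_tsum_one_div_sq {s : ℝ} (hs : 1 < s) :
    HasDerivAt (fun s : ℝ => ∑' k : ℕ, 1 / (s + k) ^ 2) (∑' k : ℕ, -2 * (1 / (s + k) ^ 3)) s := by
  refine hasDerivAt_tsum_of_isPreconnected (t := Ioi 1) (y₀ := s)
    (g' := fun (k : ℕ) (z : ℝ) => -2 * (1 / (z + k) ^ 3))
    ((summable_one_div_add_pow le_rfl (p := 3) (by norm_num)).mul_left 2) isOpen_Ioi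
    (convex_Ioi 1).isPreconnected (fun k y hy => ?_) (fun k y hy => ?_) hs
    (summable_one_div_add_pow hs.le le_rfl) hs
  · have hpos : 0 < y + k := add_pos_of_pos_of_nonneg (one_pos.trans hy) k.cast_nonneg
    have h := ((((hasDerivAt_id y).add_const (k : ℝ)).pow 2).inv (pow_pos hpos 2).ne')
    simp only [one_div]
    refine h.congr_deriv ?_
    simp only [id]
    field_simp
    norm_num
    ring
  · have hy1 : 1 < y := hy
    have hpos : 0 < y + k := by positivity
    rw [norm_mul, norm_neg, Real.norm_ofNat, Real.norm_of_nonneg (by positivity)]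
    gcongr

lemma transferOp_id_sub_le {N : ℕ} (hN : 2 ≤ N) {x y : ℝ} (hx : 0 ≤ x) (hxy : x ≤ y) :
    transferOp N id y - transferOp N id x ≤ qConst N * (y - x) := by
  have h2 : (2 : ℝ) ≤ N := by exact_mod_cast hN
  rw [transferOp_id hN hx, transferOp_id hN (hx.trans hxy)]
  have hderiv : ∀ z : ℝ, 0 ≤ z → HasDerivAt (fun z : ℝ => (1 - (N : ℝ)) +
      N * ((z + N - 1) * ∑' k : ℕ, 1 / (z + N + k) ^ 2))
      (N * (∑' k : ℕ, 1 / (z + N + k) ^ 2 -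
        2 * (z + N - 1) * ∑' k : ℕ, 1 / (z + N + k) ^ 3)) z := fun z hz => by
    have hs := (hasDerivAt_tsum_one_div_sq (s := z + N) (by linarith)).comp_add_const z (N : ℝ)
    rw [tsum_mul_left] at hs
    have h := (((((hasDerivAt_id z).add_const (N : ℝ)).sub_const 1).mul hs).const_mul
      (N : ℝ)).const_add (1 - (N : ℝ))
    refine h.congr_deriv ?_
    simp only [id]
    ring
  refine (convex_Ici 0).image_sub_le_mul_sub_of_deriv_le
    (fun z hz => (hderiv z hz).continuousAt.continuousWithinAt) (fun z hz => ?_) (fun z hz => ?_)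
    x hx y (hx.trans hxy) hxy
  · exact (hderiv z (interior_subset hz)).differentiableAt.differentiableWithinAt
  · rw [(hderiv z (interior_subset hz)).deriv]
    exact tsum_sub_le_qConst hN (interior_subset hz)

lemma abs_le_of_lipschitz_Icc {f : ℝ → ℝ} {L : ℝ}
    (hf : ∀ x ∈ Icc (0 : ℝ) 1, ∀ y ∈ Icc (0 : ℝ) 1, x ≤ y → |f y - f x| ≤ L * (y - x)) :
    ∀ z ∈ Icc (0 : ℝ) 1, |f z| ≤ |f 0| + |L| := fun z hz => by
  have h1 := hf 0 (by simp) z hz hz.1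
  have h2 : L * (z - 0) ≤ |L| := by
    rw [sub_zero]
    exact (mul_le_mul_of_nonneg_right (le_abs_self L) hz.1).trans
      (mul_le_of_le_one_right (abs_nonneg L) hz.2)
  have h3 : |f z| ≤ |f 0| + |f z - f 0| := by simpa using abs_add_le (f 0) (f z - f 0)
  linarith

/-- The transfer operator contracts the Lipschitz seminorm on `[0,1]` by the factor `q_N`. -/
lemma abs_transferOp_sub_le {N : ℕ} (hN : 2 ≤ N) {f : ℝ → ℝ} {L : ℝ} (hL : 0 ≤ L)
    (hf : ∀ x ∈ Icc (0 : ℝ) 1, ∀ y ∈ Icc (0 : ℝ) 1, x ≤ y → |f y - f x| ≤ L * (y - x)) :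
    ∀ x ∈ Icc (0 : ℝ) 1, ∀ y ∈ Icc (0 : ℝ) 1, x ≤ y →
      |transferOp N f y - transferOp N f x| ≤ L * qConst N * (y - x) := by
  intro x hx y hy hxy
  have hM := abs_le_of_lipschitz_Icc hf
  set M := |f 0| + |L|
  have hfb : ∀ z : ℝ, 0 ≤ z → Summable fun k => branchWeight N k z * f (renyiBranch N k z) :=
    fun z hz => summable_branchWeight_mul hN hz fun k => hM _ (renyiBranch_mem_Icc hN k hz)
  have hidb : ∀ z : ℝ, 0 ≤ z → Summable fun k => branchWeight N k z * id (renyiBranch N k z) :=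
    fun z hz => summable_branchWeight_mul (M := 1) hN hz fun k => by
      have h := renyiBranch_mem_Icc hN k hz
      exact (abs_of_nonneg h.1).trans_le h.2
  have hcomb : ∀ c : ℝ, |c| ≤ 1 →
      L * transferOp N id x + c * transferOp N f x ≤
        L * transferOp N id y + c * transferOp N f y := fun c hc => by
    have hlin : ∀ z : ℝ, 0 ≤ z → transferOp N (fun w => L * w + c * f w) z =
        L * transferOp N id z + c * transferOp N f z := fun z hz => by
      rw [transferOp, transferOp, transferOp, ← tsum_mul_left, ← tsum_mul_left,
        ← ((hidb z hz).mul_left L).tsum_add ((hfb z hz).mul_left c)]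
      congr 1
      ext k
      rw [id]
      ring
    rw [← hlin x hx.1, ← hlin y hy.1]
    refine transferOp_le_transferOp (M := L + M) hN hx.1 hxy (fun u hu v hv huv => ?_)
      fun z hz => ?_
    · have h1 : |c * (f v - f u)| ≤ L * (v - u) := by
        rw [abs_mul]
        exact (mul_le_of_le_one_left (abs_nonneg _) hc).trans (hf u hu v hv huv)
      linarith [neg_le_of_abs_le h1]
    · refine (abs_add_le _ _).trans (add_le_add ?_ ?_)
      · rw [abs_of_nonneg (mul_nonneg hL hz.1)]
        exact mul_le_of_le_one_right hL hz.2
      · rw [abs_mul]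
        exact (mul_le_of_le_one_left (abs_nonneg _) hc).trans (hM z hz)
  have hid := mul_le_mul_of_nonneg_left (transferOp_id_sub_le hN hx.1 hxy) hL
  have h1 := hcomb 1 (by simp)
  have h2 := hcomb (-1) (by simp)
  rw [abs_le]
  constructor <;> nlinarith

lemma abs_iterate_transferOp_sub_le {N : ℕ} (hN : 2 ≤ N) {f : ℝ → ℝ} {L : ℝ} (hL : 0 ≤ L)
    (hf : ∀ x ∈ Icc (0 : ℝ) 1, ∀ y ∈ Icc (0 : ℝ) 1, x ≤ y → |f y - f x| ≤ L * (y - x)) (n : ℕ) :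
    ∀ x ∈ Icc (0 : ℝ) 1, ∀ y ∈ Icc (0 : ℝ) 1, x ≤ y →
      |(transferOp N)^[n] f y - (transferOp N)^[n] f x| ≤ L * qConst N ^ n * (y - x) := by
  induction n with
  | zero => simpa using hf
  | succ n ih =>
    rw [Function.iterate_succ_apply', pow_succ, ← mul_assoc]
    exact abs_transferOp_sub_le hN (mul_nonneg hL (pow_nonneg (qConst_pos hN).le n)) ih

lemma measurable_renyiMap (N : ℕ) : Measurable (renyiMap N) :=
  Measurable.ite (measurableSet_singleton 1) measurable_const
    (measurable_fract.comp (measurable_const.div (measurable_const.sub measurable_id)))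

lemma renyiMap_mem_Icc (N : ℕ) (x : ℝ) : renyiMap N x ∈ Icc (0 : ℝ) 1 := by
  rw [renyiMap]
  split_ifs
  · simp
  · exact ⟨Int.fract_nonneg _, (Int.fract_lt_one _).le⟩

lemma countable_renyiMap_preimage_singleton {N : ℕ} (hN : 2 ≤ N) (c : ℝ) :
    (renyiMap N ⁻¹' {c}).Countable := by
  refine ((countable_range fun m : ℤ => 1 - (N : ℝ) / (m + c)).insert 1).mono fun z hz => ?_
  rw [mem_insert_iff, or_iff_not_imp_left]
  intro hz1
  have hN0 : (N : ℝ) ≠ 0 := by positivity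
  rw [mem_preimage, renyiMap, if_neg hz1, mem_singleton_iff] at hz
  refine ⟨⌊(N : ℝ) / (1 - z)⌋, ?_⟩
  dsimp only
  rw [← hz, Int.floor_add_fract, div_div_cancel₀ hN0]
  ring

lemma nullSingletonClass_map_renyiMap {N : ℕ} (hN : 2 ≤ N) (ν : Measure ℝ)
    [NullSingletonClass ν] : NullSingletonClass (ν.map (renyiMap N)) :=
  ⟨fun c => by
    rw [Measure.map_apply (measurable_renyiMap N) (measurableSet_singleton c)]
    exact (countable_renyiMap_preimage_singleton hN c).measure_zero ν⟩

lemma map_renyiMap_compl_Icc (N : ℕ) (ν : Measure ℝ) :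
    ν.map (renyiMap N) (Icc (0 : ℝ) 1)ᶜ = 0 := by
  rw [Measure.map_apply (measurable_renyiMap N) measurableSet_Icc.compl,
    show renyiMap N ⁻¹' (Icc (0 : ℝ) 1)ᶜ = ∅ from
      eq_empty_of_forall_notMem fun x hx => hx (renyiMap_mem_Icc N x), measure_empty]

lemma le_renyiBranch_iff {N : ℕ} (hN : 2 ≤ N) (k : ℕ) {x z : ℝ} (hx : 0 ≤ x) (hz : z < 1) :
    z ≤ renyiBranch N k x ↔ (N : ℝ) / (1 - z) ≤ x + N + k := by
  have hpos : 0 < x + N + k := by positivity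
  rw [renyiBranch, div_le_iff₀ (by linarith), le_sub_comm, div_le_iff₀ hpos, mul_comm]

lemma renyiMap_le_iff {N : ℕ} (hN : 2 ≤ N) {x z : ℝ} (hx : x ∈ Ico (0 : ℝ) 1)
    (hz : z ∈ Ico (0 : ℝ) 1) (hne : ∀ k, z ≠ renyiBranch N k 0) :
    renyiMap N z ≤ x ↔ ∃ k, z ∈ Ioc (renyiBranch N k 0) (renyiBranch N k x) := by
  have hN0 : (0 : ℝ) < N := by positivity
  have hw : (N : ℝ) ≤ N / (1 - z) := by
    rw [le_div_iff₀ (by linarith [hz.2])]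
    nlinarith [hz.1]
  rw [renyiMap, if_neg hz.2.ne]
  constructor
  · intro h
    have hfloor : (N : ℤ) ≤ ⌊(N : ℝ) / (1 - z)⌋ := Int.le_floor.2 (by exact_mod_cast hw)
    obtain ⟨k, hk⟩ := Int.le.dest hfloor
    have hk' : ((N : ℝ) + k) = ⌊(N : ℝ) / (1 - z)⌋ := by exact_mod_cast hk
    have hsplit := Int.floor_add_fract ((N : ℝ) / (1 - z))
    have hfrac := Int.fract_nonneg ((N : ℝ) / (1 - z))
    refine ⟨k, lt_of_le_of_ne ?_ (hne k).symm, ?_⟩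
    · have h0 : 0 < 0 + (N : ℝ) + k := by positivity
      rw [renyiBranch, sub_le_comm, le_div_iff₀ h0, mul_comm, ← le_div_iff₀ (by linarith [hz.2])]
      linarith
    · rw [le_renyiBranch_iff hN k hx.1 hz.2]
      linarith
  · rintro ⟨k, hlt, hle⟩
    rw [le_renyiBranch_iff hN k hx.1 hz.2] at hle
    rw [← not_le, le_renyiBranch_iff hN k le_rfl hz.2, not_le] at hlt
    have hfloor : ⌊(N : ℝ) / (1 - z)⌋ = (N + k : ℤ) := by
      rw [Int.floor_eq_iff]
      push_cast
      exact ⟨by linarith, by linarith [hx.2]⟩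
    rw [Int.fract, hfloor]
    push_cast
    linarith

open ProbabilityTheory in
lemma hasSum_cdf_map_renyiMap {N : ℕ} (hN : 2 ≤ N) (ν : Measure ℝ) [IsProbabilityMeasure ν]
    [NullSingletonClass ν] (hsupp : ν (Icc (0 : ℝ) 1)ᶜ = 0) {x : ℝ} (hx : x ∈ Ico (0 : ℝ) 1) :
    HasSum (fun k => cdf ν (renyiBranch N k x) - cdf ν (renyiBranch N k 0))
      (cdf (ν.map (renyiMap N)) x) := by
  have : IsProbabilityMeasure (ν.map (renyiMap N)) :=
    Measure.isProbabilityMeasure_map (measurable_renyiMap N).aemeasurable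
  have hae : renyiMap N ⁻¹' Iic x =ᵐ[ν]
      (⋃ k, Ioc (renyiBranch N k 0) (renyiBranch N k x) : Set ℝ) := by
    have hnull : ν (insert 1 (range fun k => renyiBranch N k 0)) = 0 :=
      ((countable_range _).insert 1).measure_zero ν
    filter_upwards [mem_ae_iff.2 hsupp, compl_mem_ae_iff.2 hnull] with z hz hz'
    rw [mem_compl_iff, mem_insert_iff, not_or] at hz'
    refine propext ((renyiMap_le_iff hN hx ⟨hz.1, lt_of_le_of_ne hz.2 hz'.1⟩
      fun k hk => hz'.2 ⟨k, hk.symm⟩).trans mem_iUnion.symm)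
  have hIoc : ∀ k, (ν (Ioc (renyiBranch N k 0) (renyiBranch N k x))).toReal =
      cdf ν (renyiBranch N k x) - cdf ν (renyiBranch N k 0) := fun k => by
    conv_lhs => rw [← measure_cdf ν]
    rw [StieltjesFunction.measure_Ioc, ENNReal.toReal_ofReal]
    exact sub_nonneg.2 (monotone_cdf ν (renyiBranch_le_renyiBranch hN le_rfl (by linarith [hx.1])))
  have hdisj : Pairwise (Function.onFun Disjoint
      fun k => Ioc (renyiBranch N k 0) (renyiBranch N k x)) := by
    refine (pairwise_disjoint_on _).2 fun k l hkl => ?_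
    have hkl' : (k : ℝ) + 1 ≤ l := by exact_mod_cast hkl
    exact Ioc_disjoint_Ioc_of_le
      (renyiBranch_le_renyiBranch hN hx.1 (by linarith [hx.2]))
  have hsum := measure_iUnion (μ := ν) hdisj fun k => measurableSet_Ioc
  have hne : ∑' k, ν (Ioc (renyiBranch N k 0) (renyiBranch N k x)) ≠ ⊤ := by
    rw [← hsum]
    exact measure_ne_top _ _
  rw [cdf_eq_real, measureReal_def, Measure.map_apply (measurable_renyiMap N) measurableSet_Iic,
    measure_congr hae, hsum, ENNReal.tsum_toReal_eq fun k => measure_ne_top _ _]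
  simpa only [hIoc] using ENNReal.hasSum_toReal hne

lemma hasDerivAt_renyiBranch {N : ℕ} (hN : 2 ≤ N) (k : ℕ) {x : ℝ} (hx : 0 ≤ x) :
    HasDerivAt (renyiBranch N k) (N / (x + N + k) ^ 2) x := by
  have hpos : x + N + k ≠ 0 := by positivity
  have h := ((hasDerivAt_const x (N : ℝ)).div
    (((hasDerivAt_id x).add_const (N : ℝ)).add_const (k : ℝ)) hpos).const_sub 1
  refine h.congr_deriv ?_
  simp only [id]
  ring

open ProbabilityTheory in
/-- If `ν` has density `f x / (x + N - 1)`, then its image under `R_N` has density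
`transferOp N f x / (x + N - 1)`. -/
lemma hasDerivAt_cdf_map_renyiMap {N : ℕ} (hN : 2 ≤ N) (ν : Measure ℝ) [IsProbabilityMeasure ν]
    [NullSingletonClass ν] (hsupp : ν (Icc (0 : ℝ) 1)ᶜ = 0) {f : ℝ → ℝ} {M : ℝ}
    (hM : ∀ z ∈ Icc (0 : ℝ) 1, |f z| ≤ M)
    (hf : ∀ x ∈ Ioo (0 : ℝ) 1, HasDerivAt (cdf ν) (f x / (x + N - 1)) x) :
    ∀ x ∈ Ioo (0 : ℝ) 1,
      HasDerivAt (cdf (ν.map (renyiMap N))) (transferOp N f x / (x + N - 1)) x := by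
  intro x hx
  have h2 : (2 : ℝ) ≤ N := by exact_mod_cast hN
  have hbranch : ∀ k, ∀ y ∈ Ioo (0 : ℝ) 1, renyiBranch N k y ∈ Ioo (0 : ℝ) 1 := fun k y hy => by
    refine ⟨?_, (renyiBranch_mem_Ico hN k hy.1.le).2⟩
    have hk : (0 : ℝ) ≤ k := k.cast_nonneg
    rw [renyiBranch, sub_pos, div_lt_one (by linarith [hy.1])]
    linarith [hy.1]
  have hderiv := hasDerivAt_tsum_of_isPreconnected (t := Ioo (0 : ℝ) 1) (y₀ := x) (y := x)
    (g := fun k y => cdf ν (renyiBranch N k y) - cdf ν (renyiBranch N k 0))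
    (g' := fun k y => f (renyiBranch N k y) / (renyiBranch N k y + N - 1) *
      (N / (y + N + k) ^ 2))
    (u := fun k : ℕ => M * N * (1 / (1 + (k : ℝ)) ^ 2))
    ((summable_one_div_add_pow le_rfl le_rfl).mul_left _) isOpen_Ioo
    (convex_Ioo 0 1).isPreconnected
    (fun k y hy => (((hf _ (hbranch k y hy)).comp y
      (hasDerivAt_renyiBranch hN k hy.1.le)).sub_const _))
    (fun k y hy => ?_) hx (hasSum_cdf_map_renyiMap hN ν hsupp ⟨hx.1.le, hx.2⟩).summable hx
  · have heq : cdf (ν.map (renyiMap N)) =ᶠ[nhds x]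
        fun y => ∑' k, (cdf ν (renyiBranch N k y) - cdf ν (renyiBranch N k 0)) := by
      filter_upwards [isOpen_Ioo.mem_nhds hx] with y hy
      exact (hasSum_cdf_map_renyiMap hN ν hsupp ⟨hy.1.le, hy.2⟩).tsum_eq.symm
    refine (hderiv.congr_of_eventuallyEq heq).congr_deriv ?_
    rw [transferOp, ← tsum_div_const]
    congr 1
    ext k
    have hk : (0 : ℝ) ≤ k := k.cast_nonneg
    have h1 : x + N + k - 1 ≠ 0 := by linarith [hx.1]
    have h3 : x + N + k ≠ 0 := by linarith [hx.1]
    have h4 : x + N - 1 ≠ 0 := by linarith [hx.1]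
    have h5 : renyiBranch N k x + N - 1 = N * (x + N + k - 1) / (x + N + k) := by
      rw [renyiBranch]
      field_simp
      ring
    rw [branchWeight, h5]
    field_simp
  · have hmem := renyiBranch_mem_Icc hN k hy.1.le
    have hpos : 1 ≤ renyiBranch N k y + N - 1 := by linarith [hmem.1]
    have hM0 : 0 ≤ M := (abs_nonneg _).trans (hM _ hmem)
    have hy0 := hy.1
    rw [norm_mul, norm_div, Real.norm_eq_abs, Real.norm_of_nonneg (by linarith),
      Real.norm_of_nonneg (by positivity), mul_assoc M, mul_one_div]
    refine mul_le_mul ?_ ?_ (by positivity) hM0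
    · exact (div_le_self (abs_nonneg _) hpos).trans (hM _ hmem)
    · gcongr
      linarith

open ProbabilityTheory in
lemma continuous_cdf (ν : Measure ℝ) [IsProbabilityMeasure ν] [NullSingletonClass ν] :
    Continuous (cdf ν) := by
  refine continuous_iff_continuousAt.2 fun x => ?_
  rw [(monotone_cdf ν).continuousAt_iff_leftLim_eq_rightLim, StieltjesFunction.rightLim_eq]
  refine le_antisymm ((monotone_cdf ν).leftLim_le le_rfl) ?_
  have h := StieltjesFunction.measure_singleton (cdf ν) x
  rw [measure_cdf, measure_singleton, eq_comm, ENNReal.ofReal_eq_zero] at h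
  linarith

open ProbabilityTheory in
/-- A distribution on `[0,1]` whose density relative to `1 / (x + N - 1)` is `L`-Lipschitz is
uniformly `L`-close to the invariant distribution of `R_N`. -/
lemma abs_cdf_sub_log_le {N : ℕ} (hN : 2 ≤ N) (ν : Measure ℝ) [IsProbabilityMeasure ν]
    [NullSingletonClass ν] (hsupp : ν (Icc (0 : ℝ) 1)ᶜ = 0) {f : ℝ → ℝ} {L : ℝ} (hL : 0 ≤ L)
    (hlip : ∀ x ∈ Icc (0 : ℝ) 1, ∀ y ∈ Icc (0 : ℝ) 1, x ≤ y → |f y - f x| ≤ L * (y - x))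
    (hf : ∀ x ∈ Ioo (0 : ℝ) 1, HasDerivAt (cdf ν) (f x / (x + N - 1)) x) :
    ∀ x ∈ Icc (0 : ℝ) 1,
      |cdf ν x - Real.log ((x + N - 1) / (N - 1)) / Real.log ((N : ℝ) / (N - 1))| ≤ L := by
  have h2 : (2 : ℝ) ≤ N := by exact_mod_cast hN
  have hN1 : (0 : ℝ) < N - 1 := by linarith
  have hlog : 0 < Real.log ((N : ℝ) / (N - 1)) := Real.log_pos (by
    rw [one_lt_div hN1]
    linarith)
  set ℓ := Real.log ((N : ℝ) / (N - 1)) with hℓ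
  set D : ℝ → ℝ := fun x => cdf ν x - Real.log ((x + N - 1) / (N - 1)) / ℓ with hD
  have hlogderiv : ∀ x : ℝ, 0 ≤ x →
      HasDerivAt (fun x : ℝ => Real.log ((x + N - 1) / (N - 1)) / ℓ) (1 / ℓ / (x + N - 1)) x :=
    fun x hx => by
      have hpos : 0 < x + N - 1 := by linarith
      have h := (((((hasDerivAt_id x).add_const (N : ℝ)).sub_const 1).div_const
        ((N : ℝ) - 1)).log (by simp only [id]; positivity)).div_const ℓ
      refine h.congr_deriv ?_
      simp only [id]
      field_simp
  have hDderiv : ∀ x ∈ Ioo (0 : ℝ) 1, HasDerivAt D ((f x - 1 / ℓ) / (x + N - 1)) x :=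
    fun x hx => by
      rw [sub_div]
      exact (hf x hx).sub (hlogderiv x hx.1.le)
  have hDcont : ContinuousOn D (Icc 0 1) := fun x hx =>
    ((continuous_cdf ν).continuousAt.sub (hlogderiv x hx.1).continuousAt).continuousWithinAt
  have hD0 : D 0 = 0 := by
    have hcdf : cdf ν 0 = 0 := by
      have hneg : ν (Iio 0) = 0 :=
        measure_mono_null (t := (Icc (0 : ℝ) 1)ᶜ)
          (fun z hz hz' => (mem_Iio.1 hz).not_ge hz'.1) hsupp
      rw [cdf_eq_real, measureReal_def, ← Iio_union_right,
        measure_union_null hneg (measure_singleton _), ENNReal.toReal_zero]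
    simp only [hD, hcdf, zero_add]
    rw [div_self hN1.ne', Real.log_one, zero_div, sub_zero]
  have hD1 : D 1 = 0 := by
    have hcdf : cdf ν 1 = 1 := by
      have h : ν (Iic (1 : ℝ))ᶜ = 0 := measure_mono_null
        (compl_subset_compl.2 fun z hz => hz.2) hsupp
      rw [cdf_eq_real, measureReal_def, (prob_compl_eq_zero_iff measurableSet_Iic).1 h,
        ENNReal.toReal_one]
    simp only [hD, hcdf, add_sub_cancel_left, ← hℓ, div_self hlog.ne', sub_self]
  obtain ⟨ξ, hξ, hξ0⟩ := exists_hasDerivAt_eq_zero one_pos hDcont (hD0.trans hD1.symm) hDderiv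
  have hfξ : f ξ = 1 / ℓ := by
    rw [div_eq_zero_iff, or_iff_left (by linarith [hξ.1])] at hξ0
    linarith
  have hbound : ∀ x ∈ Ioo (0 : ℝ) 1, |(f x - 1 / ℓ) / (x + N - 1)| ≤ L := fun x hx => by
    have hx' := Ioo_subset_Icc_self hx
    have hξ' := Ioo_subset_Icc_self hξ
    have hnum : |f x - f ξ| ≤ L := by
      rcases le_total x ξ with h | h
      · rw [abs_sub_comm]
        exact (hlip x hx' ξ hξ' h).trans (mul_le_of_le_one_right hL (by linarith [hx'.1, hξ'.2]))
      · exact (hlip ξ hξ' x hx' h).trans (mul_le_of_le_one_right hL (by linarith [hξ'.1, hx'.2]))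
    rw [← hfξ, abs_div, abs_of_pos (by linarith [hx.1] : 0 < x + (N : ℝ) - 1)]
    exact (div_le_self (abs_nonneg _) (by linarith [hx.1])).trans hnum
  intro x hx
  rcases hx.1.eq_or_lt with rfl | hx0
  · change |D 0| ≤ L
    rwa [hD0, abs_zero]
  · obtain ⟨c, hc, hslope⟩ := exists_hasDerivAt_eq_slope D _ hx0
      (hDcont.mono (Icc_subset_Icc_right hx.2)) fun y hy => hDderiv y ⟨hy.1, hy.2.trans_le hx.2⟩
    have hb := hbound c ⟨hc.1, hc.2.trans_le hx.2⟩
    rw [hslope, hD0, sub_zero, sub_zero, abs_div, abs_of_pos hx0, div_le_iff₀ hx0] at hb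
    exact hb.trans (mul_le_of_le_one_right hL hx.2)

/-- A `C²` distribution function on `[0,1]` has a Lipschitz density relative to
`1 / (x + N - 1)`. -/
lemma exists_lipschitz_density {F : ℝ → ℝ} (hF : ContDiffOn ℝ 2 F (Icc 0 1)) {N : ℕ}
    (hN : 2 ≤ N) :
    ∃ (f : ℝ → ℝ) (L : ℝ), 0 ≤ L ∧
      (∀ x ∈ Icc (0 : ℝ) 1, ∀ y ∈ Icc (0 : ℝ) 1, x ≤ y → |f y - f x| ≤ L * (y - x)) ∧
      ∀ x ∈ Ioo (0 : ℝ) 1, HasDerivAt F (f x / (x + N - 1)) x := by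
  have h2 : (2 : ℝ) ≤ N := by exact_mod_cast hN
  have hu : UniqueDiffOn ℝ (Icc (0 : ℝ) 1) := uniqueDiffOn_Icc one_pos
  set f : ℝ → ℝ := fun x => (x + N - 1) * derivWithin F (Icc 0 1) x with hfdef
  have hf : ContDiffOn ℝ 1 f (Icc 0 1) :=
    (ContDiff.contDiffOn (by fun_prop)).mul (hF.derivWithin hu (by norm_num))
  obtain ⟨L, hL⟩ := isCompact_Icc.exists_bound_of_continuousOn
    (hf.continuousOn_derivWithin hu le_rfl)
  refine ⟨f, L, (norm_nonneg _).trans (hL 0 (by simp)), fun x hx y hy hxy => ?_, fun x hx => ?_⟩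
  · have h := (convex_Icc (0 : ℝ) 1).norm_image_sub_le_of_norm_derivWithin_le
      (hf.differentiableOn one_ne_zero) hL hx hy
    rwa [Real.norm_eq_abs, Real.norm_of_nonneg (sub_nonneg.2 hxy)] at h
  · have hd := ((hF.differentiableOn two_ne_zero) x
      (Ioo_subset_Icc_self hx)).hasDerivWithinAt.hasDerivAt (Icc_mem_nhds hx.1 hx.2)
    refine hd.congr_deriv ?_
    rw [hfdef, mul_div_cancel_left₀ _ (by linarith [hx.1])]

open ProbabilityTheory in
lemma Fdist_eq_cdf (N : ℕ) (μ : Measure ℝ) [IsProbabilityMeasure μ]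
    (hsupp : μ (Icc (0 : ℝ) 1)ᶜ = 0) (n : ℕ) (x : ℝ) :
    Fdist N μ n x = cdf (μ.map (renyiMap N)^[n]) x := by
  have hmeas := (measurable_renyiMap N).iterate n
  have := Measure.isProbabilityMeasure_map (μ := μ) hmeas.aemeasurable
  rw [cdf_eq_real, measureReal_def, Measure.map_apply hmeas measurableSet_Iic, Fdist]
  congr 1
  refine measure_congr ?_
  filter_upwards [mem_ae_iff.2 hsupp] with z hz
  exact propext (and_iff_right hz)

open ProbabilityTheory in
lemma iterate_renyiMap_density {N : ℕ} (hN : 2 ≤ N) (μ : Measure ℝ) [IsProbabilityMeasure μ]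
    [NullSingletonClass μ] (hsupp : μ (Icc (0 : ℝ) 1)ᶜ = 0) {f : ℝ → ℝ} {L : ℝ} (hL : 0 ≤ L)
    (hlip : ∀ x ∈ Icc (0 : ℝ) 1, ∀ y ∈ Icc (0 : ℝ) 1, x ≤ y → |f y - f x| ≤ L * (y - x))
    (hf : ∀ x ∈ Ioo (0 : ℝ) 1, HasDerivAt (cdf μ) (f x / (x + N - 1)) x) (n : ℕ) :
    NullSingletonClass (μ.map (renyiMap N)^[n]) ∧
      μ.map (renyiMap N)^[n] (Icc (0 : ℝ) 1)ᶜ = 0 ∧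
      ∀ x ∈ Ioo (0 : ℝ) 1, HasDerivAt (cdf (μ.map (renyiMap N)^[n]))
        ((transferOp N)^[n] f x / (x + N - 1)) x := by
  induction n with
  | zero =>
    simp only [Function.iterate_zero, Measure.map_id]
    exact ⟨inferInstance, hsupp, hf⟩
  | succ n ih =>
    obtain ⟨hnull, hsupp', hderiv⟩ := ih
    have hmeas := (measurable_renyiMap N).iterate n
    have := Measure.isProbabilityMeasure_map (μ := μ) hmeas.aemeasurable
    rw [Function.iterate_succ', ← Measure.map_map (measurable_renyiMap N) hmeas,
      Function.iterate_succ_apply']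
    exact ⟨nullSingletonClass_map_renyiMap hN _, map_renyiMap_compl_Icc N _,
      hasDerivAt_cdf_map_renyiMap hN _ hsupp'
        (abs_le_of_lipschitz_Icc (abs_iterate_transferOp_sub_le hN hL hlip n)) hderiv⟩

/-- A Gauss-Kuzmin-Lévy-type theorem for Rényi-type continued fractions. -/
theorem gauss_kuzmin_levy (N : ℕ) (hN : 2 ≤ N) (μ : Measure ℝ)
    [IsProbabilityMeasure μ] [NullSingletonClass μ] (hsupp : μ (Icc (0 : ℝ) 1)ᶜ = 0)
    (hsmooth : ContDiffOn ℝ 2 (Fdist N μ 0) (Icc 0 1)) :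
    0 < qConst N ∧ qConst N < 1 ∧
      ∃ C > 0, ∀ n : ℕ, ∀ x ∈ Icc (0 : ℝ) 1,
        |Fdist N μ n x -
            Real.log ((x + N - 1) / (N - 1)) / Real.log ((N : ℝ) / (N - 1))| ≤
          C * qConst N ^ n := by
  refine ⟨qConst_pos hN, qConst_lt_one hN, ?_⟩
  obtain ⟨f, L, hL, hlip, hf⟩ := exists_lipschitz_density hsmooth hN
  have hFcdf : Fdist N μ 0 = ProbabilityTheory.cdf μ := by
    ext x
    rw [Fdist_eq_cdf N μ hsupp, Function.iterate_zero, Measure.map_id]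
  rw [hFcdf] at hf
  refine ⟨L + 1, by linarith, fun n x hx => ?_⟩
  have hq := pow_nonneg (qConst_pos hN).le n
  obtain ⟨hnull, hsupp', hderiv⟩ := iterate_renyiMap_density hN μ hsupp hL hlip hf n
  have := Measure.isProbabilityMeasure_map (μ := μ)
    ((measurable_renyiMap N).iterate n).aemeasurable
  rw [Fdist_eq_cdf N μ hsupp]
  exact (abs_cdf_sub_log_le hN _ hsupp' (mul_nonneg hL hq)
    (abs_iterate_transferOp_sub_le hN hL hlip n) hderiv x hx).trans
    (mul_le_mul_of_nonneg_right (by linarith) hq)
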